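/- Let 1 < α < 2, T > 0 and θ ∈ ((α−1)/(2α), 1/2). Let (λ_n) be a sequence of positive reals, and let (a_n), (b_n) be real sequences with Σ_n λ_n a_n² < ∞ and Σ_n b_n² < ∞. Then there exists C > 0 such that ∫_0^T Σ_{n=1}^∞ λ_n^{2−2θ} | a_n E_{α,1}(−λ_n t^α) + b_n t E_{α,2}(−λ_n t^α) |² dt ≤ C ( Σ_n λ_n a_n² + Σ_n b_n² ). (This is the spectral-coefficient form of the estimate ‖∂_t^α u‖_{L²(0,T;D(A^{−θ}))} ≤ C(‖u₀‖_{H¹₀(Ω)} + ‖u₁‖_{L²(Ω)}).) -/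

import Mathlib

open Complex Real MeasureTheory

/-- The Mittag–Leffler function `E_{α,β}(z) = Σ_{k=0}^∞ z^k / Γ(αk + β)`. -/
noncomputable def mittagLeffler (α β : ℝ) (z : ℂ) : ℂ :=
  ∑' k : ℕ, z ^ k / Complex.Gamma ((α * k + β : ℝ) : ℂ)

theorem integrableOn_rpow_mul_exp_neg_mul {s b : ℝ} (hs : -1 < s) (hb : 0 < b) :
    IntegrableOn (fun t : ℝ => t ^ s * Real.exp (-(b * t))) (Set.Ioi 0) := by
  simpa [Real.rpow_one, neg_mul] using
    integrableOn_rpow_mul_exp_neg_mul_rpow (p := 1) hs one_pos hb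

theorem norm_rpow_mul_cexp_neg_mul {s t : ℝ} (ht : 0 < t) (z : ℂ) :
    ‖((t ^ s : ℝ) : ℂ) * Complex.exp (-(z * t))‖ = t ^ s * Real.exp (-(z.re * t)) := by
  rw [norm_mul, Complex.norm_exp, Complex.norm_real, Real.norm_of_nonneg (by positivity)]
  simp

theorem aestronglyMeasurable_rpow_mul_cexp_neg_mul (s : ℝ) (z : ℂ) :
    AEStronglyMeasurable (fun t : ℝ => ((t ^ s : ℝ) : ℂ) * Complex.exp (-(z * t)))
      (volume.restrict (Set.Ioi 0)) :=
  Measurable.aestronglyMeasurable (by fun_prop)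

theorem integrableOn_rpow_mul_cexp_neg_mul {s : ℝ} (hs : -1 < s) {z : ℂ} (hz : 0 < z.re) :
    IntegrableOn (fun t : ℝ => ((t ^ s : ℝ) : ℂ) * Complex.exp (-(z * t))) (Set.Ioi 0) := by
  refine (integrableOn_rpow_mul_exp_neg_mul hs hz).mono'
    (aestronglyMeasurable_rpow_mul_cexp_neg_mul s z) ?_
  filter_upwards [ae_restrict_mem measurableSet_Ioi] with t ht
  exact (norm_rpow_mul_cexp_neg_mul ht z).le

theorem differentiableOn_integral_rpow_mul_cexp_neg_mul {s : ℝ} (hs : -1 < s) :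
    DifferentiableOn ℂ
      (fun z : ℂ => ∫ t : ℝ in Set.Ioi 0, ((t ^ s : ℝ) : ℂ) * Complex.exp (-(z * t)))
      {z | 0 < z.re} := by
  intro z₀ hz₀
  simp only [Set.mem_ofPred_eq] at hz₀
  refine DifferentiableAt.differentiableWithinAt ?_
  have hU : {z : ℂ | z₀.re / 2 < z.re} ∈ nhds z₀ :=
    (isOpen_lt continuous_const Complex.continuous_re).mem_nhds (by simp; linarith)
  refine (hasDerivAt_integral_of_dominated_loc_of_deriv_le
    (F' := fun z t => -(((t ^ (s + 1) : ℝ) : ℂ) * Complex.exp (-(z * t))))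
    (bound := fun t => t ^ (s + 1) * Real.exp (-(z₀.re / 2 * t))) hU
    (Filter.Eventually.of_forall fun z => aestronglyMeasurable_rpow_mul_cexp_neg_mul s z)
    (integrableOn_rpow_mul_cexp_neg_mul hs hz₀)
    (aestronglyMeasurable_rpow_mul_cexp_neg_mul (s + 1) z₀).neg ?_
    (integrableOn_rpow_mul_exp_neg_mul (by linarith) (by linarith)) ?_).2.differentiableAt
  · filter_upwards [ae_restrict_mem measurableSet_Ioi] with t (ht : 0 < t) z hz
    rw [norm_neg, norm_rpow_mul_cexp_neg_mul ht]
    have hz' : z₀.re / 2 ≤ z.re := le_of_lt hz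
    gcongr
  · filter_upwards [ae_restrict_mem measurableSet_Ioi] with t (ht : 0 < t) z _
    have h := ((((hasDerivAt_id z).mul_const (t : ℂ)).neg).cexp).const_mul ((t ^ s : ℝ) : ℂ)
    refine h.congr_deriv ?_
    rw [Real.rpow_add_one ht.ne']
    simp
    ring

theorem integral_rpow_mul_cexp_neg_mul {p : ℝ} (hp : 0 < p) {z : ℂ} (hz : 0 < z.re) :
    ∫ t : ℝ in Set.Ioi 0, ((t ^ (p - 1) : ℝ) : ℂ) * Complex.exp (-(z * t)) =
      z ^ (-p : ℂ) * Complex.Gamma p := by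
  have hopen : IsOpen {z : ℂ | 0 < z.re} := isOpen_lt continuous_const Complex.continuous_re
  have hd : DifferentiableOn ℂ (fun z : ℂ => z ^ (-p : ℂ) * Complex.Gamma p) {z | 0 < z.re} := by
    intro w hw
    refine DifferentiableAt.differentiableWithinAt ?_
    exact ((differentiableAt_id).cpow_const (Or.inl hw)).mul_const _
  refine AnalyticOnNhd.eqOn_of_preconnected_of_frequently_eq
    ((differentiableOn_integral_rpow_mul_cexp_neg_mul (s := p - 1) (by linarith)).analyticOnNhd
      hopen) (hd.analyticOnNhd hopen)
    (convex_halfSpace_re_gt 0).isPreconnected (z₀ := 1) (by simp) ?_ hz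
  have key : ∀ r : ℝ, 0 < r →
      ∫ t : ℝ in Set.Ioi 0, ((t ^ (p - 1) : ℝ) : ℂ) * Complex.exp (-((r : ℂ) * t)) =
      (r : ℂ) ^ (-p : ℂ) * Complex.Gamma p := by
    intro r hr
    have h := Complex.integral_cpow_mul_exp_neg_mul_Ioi (a := (p : ℂ)) (r := r) (by simpa) hr
    rw [one_div, Complex.inv_cpow _ _ (by
      rw [Complex.arg_ofReal_of_nonneg hr.le]; exact Real.pi_pos.ne), ← Complex.cpow_neg] at h
    rw [← h]
    refine setIntegral_congr_fun measurableSet_Ioi fun t ht => ?_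
    simp only [Set.mem_Ioi] at ht
    simp only [Complex.ofReal_cpow ht.le, Complex.ofReal_sub, Complex.ofReal_one]
  have ht : Filter.Tendsto (fun r : ℝ => (r : ℂ)) (nhdsWithin 1 {1}ᶜ) (nhdsWithin 1 {1}ᶜ) := by
    refine tendsto_nhdsWithin_iff.2 ⟨?_, ?_⟩
    · exact (Complex.continuous_ofReal.tendsto' 1 1 (by simp)).mono_left nhdsWithin_le_nhds
    · filter_upwards [self_mem_nhdsWithin] with r hr
      simpa using hr
  refine ht.frequently (Filter.Eventually.frequently ?_)
  have : ∀ᶠ r : ℝ in nhdsWithin 1 {1}ᶜ, 0 < r :=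
    nhdsWithin_le_nhds (lt_mem_nhds one_pos)
  filter_upwards [this] with r hr using key r hr

theorem le_norm_add_mul_I {c : ℝ} (hc : 0 < c) (y : ℝ) :
    min c 1 / 2 * (1 + ‖y‖) ≤ ‖(c + y * Complex.I : ℂ)‖ := by
  have h1 : c ≤ ‖(c + y * Complex.I : ℂ)‖ := by
    have := Complex.abs_re_le_norm (c + y * Complex.I : ℂ)
    simp at this
    exact (le_abs_self c).trans this
  have h2 : |y| ≤ ‖(c + y * Complex.I : ℂ)‖ := by
    have := Complex.abs_im_le_norm (c + y * Complex.I : ℂ)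
    simpa using this
  have h3 := min_le_left c 1
  have h4 := min_le_right c 1
  have h5 : 0 < min c 1 := lt_min hc one_pos
  rw [Real.norm_eq_abs]
  nlinarith [abs_nonneg y, mul_le_mul_of_nonneg_right h4 (abs_nonneg y)]

theorem add_mul_I_ne_zero {c : ℝ} (hc : 0 < c) (y : ℝ) : (c + y * Complex.I : ℂ) ≠ 0 := by
  intro h
  have := congrArg Complex.re h
  simp at this
  exact hc.ne' this

theorem integrable_norm_add_mul_I_rpow {c p : ℝ} (hc : 0 < c) (hp : 1 < p) :
    Integrable fun y : ℝ => ‖(c + y * Complex.I : ℂ)‖ ^ (-p) := by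
  have h5 : 0 < min c 1 := lt_min hc one_pos
  refine ((integrable_one_add_norm (E := ℝ) (μ := volume) (r := p) (by simpa)).const_mul
    ((min c 1 / 2) ^ (-p))).mono' (Measurable.aestronglyMeasurable (by fun_prop)) ?_
  refine Filter.Eventually.of_forall fun y => ?_
  rw [Real.norm_of_nonneg (by positivity), ← Real.mul_rpow (by positivity) (by positivity)]
  exact Real.rpow_le_rpow_of_nonpos (by positivity) (le_norm_add_mul_I hc y) (by linarith)

theorem integral_cexp_mul_cpow_eq {c p : ℝ} (hc : 0 < c) (hp : 1 < p) :
    ∫ y : ℝ, Complex.exp (c + y * Complex.I) * (c + y * Complex.I : ℂ) ^ (-p : ℂ) =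
      2 * Real.pi / Complex.Gamma p := by
  have hG : Complex.Gamma p ≠ 0 := Complex.Gamma_ne_zero_of_re_pos (by simp; linarith)
  set f : ℝ → ℂ := (Set.Ioi (0 : ℝ)).indicator
    (fun t => ((t ^ (p - 1) : ℝ) : ℂ) * Complex.exp (-(c * t))) with hf
  have hfi : Integrable f :=
    (integrable_indicator_iff measurableSet_Ioi).2
      (integrableOn_rpow_mul_cexp_neg_mul (by linarith) (by simpa))
  have hF : ∀ ξ : ℝ, FourierTransform.fourier f ξ =
      (c + (2 * Real.pi * ξ : ℝ) * Complex.I : ℂ) ^ (-p : ℂ) * Complex.Gamma p := by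
    intro ξ
    rw [Real.fourier_real_eq_integral_exp_smul,
      ← integral_rpow_mul_cexp_neg_mul (by linarith) (by simpa),
      ← integral_indicator measurableSet_Ioi]
    refine integral_congr_ae (Filter.Eventually.of_forall fun t => ?_)
    by_cases ht : t ∈ Set.Ioi (0 : ℝ)
    · simp only [hf, Set.indicator_of_mem ht, smul_eq_mul]
      rw [mul_left_comm, ← Complex.exp_add]
      congr 2
      push_cast
      ring
    · simp [hf, Set.indicator_of_notMem ht]
  have hpi : (0 : ℝ) < 2 * Real.pi := by positivity
  have hcont : ContinuousAt f 1 := by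
    have : f =ᶠ[nhds 1] fun t : ℝ => ((t ^ (p - 1) : ℝ) : ℂ) * Complex.exp (-(c * t)) := by
      filter_upwards [lt_mem_nhds (one_pos : (0 : ℝ) < 1)] with t ht
      simp only [hf, Set.indicator_of_mem (Set.mem_Ioi.2 ht)]
    refine ContinuousAt.congr ?_ this.symm
    refine ContinuousAt.mul ?_ (by fun_prop)
    exact Complex.continuous_ofReal.continuousAt.comp
      (Real.continuousAt_rpow_const _ _ (Or.inl one_ne_zero))
  have hFi : Integrable (FourierTransform.fourier f) := by
    have : Integrable fun y : ℝ => (c + y * Complex.I : ℂ) ^ (-p : ℂ) * Complex.Gamma p := by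
      refine Integrable.mul_const ?_ _
      refine (integrable_norm_add_mul_I_rpow hc hp).mono'
        (Measurable.aestronglyMeasurable (by fun_prop)) (Filter.Eventually.of_forall fun y => ?_)
      rw [← Complex.ofReal_neg, Complex.norm_cpow_real]
    have h := this.comp_mul_left' hpi.ne'
    exact h.congr (Filter.Eventually.of_forall fun ξ => (hF ξ).symm)
  have hinv := hfi.fourierInv_fourier_eq hFi hcont
  rw [Real.fourierInv_eq'] at hinv
  simp only [hF] at hinv
  have h1 : f 1 = Complex.exp (-c) := by
    simp [hf]
  have h2 := Measure.integral_comp_mul_left (fun y : ℝ => Complex.exp (y * Complex.I) *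
    ((c + y * Complex.I : ℂ) ^ (-p : ℂ) * Complex.Gamma p)) (2 * Real.pi)
  rw [abs_of_pos (inv_pos.2 hpi)] at h2
  have h3 : ∫ y : ℝ, Complex.exp (y * Complex.I) *
      ((c + y * Complex.I : ℂ) ^ (-p : ℂ) * Complex.Gamma p) =
        2 * Real.pi * Complex.exp (-c) := by
    have h4 : Complex.exp (-c) = ((2 * Real.pi)⁻¹ : ℝ) • ∫ y : ℝ, Complex.exp (y * Complex.I) *
        ((c + y * Complex.I : ℂ) ^ (-p : ℂ) * Complex.Gamma p) := by
      rw [← h1, ← hinv, ← h2]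
      simp
    rw [h4, Complex.real_smul]
    push_cast
    rw [← mul_assoc, mul_inv_cancel₀ (by exact_mod_cast hpi.ne'), one_mul]
  simp only [← mul_assoc] at h3
  rw [integral_mul_const] at h3
  rw [eq_div_iff hG]
  simp only [Complex.exp_add, mul_assoc]
  rw [integral_const_mul, mul_assoc, h3, mul_left_comm, ← Complex.exp_add]
  simp

theorem integrable_of_norm_le_norm_add_mul_I_rpow {g : ℂ → ℂ} {c M p : ℝ} (hc : 0 < c)
    (hp : 1 < p) (hg : DifferentiableOn ℂ g {z | 0 < z.re})
    (hb : ∀ z : ℂ, z.re = c → ‖g z‖ ≤ M * ‖z‖ ^ (-p)) :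
    Integrable fun y : ℝ => g (c + y * Complex.I) := by
  refine ((integrable_norm_add_mul_I_rpow hc hp).const_mul M).mono' ?_
    (Filter.Eventually.of_forall fun y => hb _ (by simp))
  refine Continuous.aestronglyMeasurable ?_
  exact hg.continuousOn.comp_continuous (by fun_prop) (fun y => by simpa)

theorem integral_vertical_line_eq {g : ℂ → ℂ} {a c M p : ℝ} (ha : 0 < a) (hac : a ≤ c)
    (hp : 1 < p) (hM : 0 ≤ M) (hg : DifferentiableOn ℂ g {z | 0 < z.re})
    (hb : ∀ z : ℂ, a ≤ z.re → z.re ≤ c → ‖g z‖ ≤ M * ‖z‖ ^ (-p)) :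
    ∫ y : ℝ, g (a + y * Complex.I) = ∫ y : ℝ, g (c + y * Complex.I) := by
  have hia := integrable_of_norm_le_norm_add_mul_I_rpow ha hp hg
    (fun z hz => hb z hz.ge (hz.le.trans hac))
  have hic := integrable_of_norm_le_norm_add_mul_I_rpow (ha.trans_le hac) hp hg
    (fun z hz => hb z (hac.trans hz.ge) hz.le)
  have hta := intervalIntegral_tendsto_integral hia Filter.tendsto_neg_atTop_atBot
    Filter.tendsto_id
  have htc := intervalIntegral_tendsto_integral hic Filter.tendsto_neg_atTop_atBot
    Filter.tendsto_id
  have hzero : Filter.Tendsto (fun R : ℝ => M * R ^ (-p) * |c - a|) Filter.atTop (nhds 0) := by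
    simpa using ((tendsto_rpow_neg_atTop (by linarith : 0 < p)).const_mul M).mul_const |c - a|
  have hbound : ∀ R : ℝ, 0 < R → ∀ r : ℝ, |r| = R →
      ‖∫ x : ℝ in a..c, g (x + r * Complex.I)‖ ≤ M * R ^ (-p) * |c - a| := by
    intro R hR r hr
    refine intervalIntegral.norm_integral_le_of_norm_le_const fun x hx => ?_
    rw [Set.uIoc_of_le hac] at hx
    refine (hb _ (by simpa using hx.1.le) (by simpa using hx.2)).trans ?_
    gcongr 1
    refine Real.rpow_le_rpow_of_nonpos hR ?_ (by linarith)
    have := Complex.abs_im_le_norm (x + r * Complex.I : ℂ)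
    simpa [hr] using this
  have hup : Filter.Tendsto (fun R : ℝ => ∫ x : ℝ in a..c, g (x + (R : ℝ) * Complex.I))
      Filter.atTop (nhds 0) := by
    refine squeeze_zero_norm' ?_ hzero
    filter_upwards [Filter.eventually_gt_atTop 0] with R hR
    exact hbound R hR R (abs_of_pos hR)
  have hdown : Filter.Tendsto (fun R : ℝ => ∫ x : ℝ in a..c, g (x + (-R : ℝ) * Complex.I))
      Filter.atTop (nhds 0) := by
    refine squeeze_zero_norm' ?_ hzero
    filter_upwards [Filter.eventually_gt_atTop 0] with R hR
    exact hbound R hR (-R) (by rw [abs_neg, abs_of_pos hR])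
  have hrect : ∀ R : ℝ, (∫ x : ℝ in a..c, g (x + (-R : ℝ) * Complex.I)) -
      (∫ x : ℝ in a..c, g (x + (R : ℝ) * Complex.I)) +
      Complex.I • (∫ y : ℝ in (-R)..R, g (c + y * Complex.I)) -
      Complex.I • (∫ y : ℝ in (-R)..R, g (a + y * Complex.I)) = 0 := by
    intro R
    have h := Complex.integral_boundary_rect_eq_zero_of_differentiableOn g
      (⟨a, -R⟩ : ℂ) (⟨c, R⟩ : ℂ) (hg.mono fun z hz => by
        have := hz.1
        simp only [Set.mem_preimage, Set.uIcc_of_le hac] at this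
        exact ha.trans_le this.1)
    simpa using h
  have hlim := (((hdown.sub hup).add (htc.const_smul Complex.I)).sub (hta.const_smul Complex.I))
  have h0 := tendsto_nhds_unique hlim ((tendsto_const_nhds (x := (0 : ℂ))).congr
    (fun R => (hrect R).symm))
  simp only [sub_zero, zero_add, smul_eq_mul, ← mul_sub, mul_eq_zero, Complex.I_ne_zero,
    false_or] at h0
  exact (sub_eq_zero.1 h0).symm

theorem norm_cpow_ofReal_mul (x : ℝ) (hx : 0 ≤ x) (α : ℝ) (s : ℂ) :
    ‖(x : ℂ) * s ^ ((-α : ℝ) : ℂ)‖ = x * ‖s‖ ^ (-α) := by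
  rw [norm_mul, Complex.norm_cpow_real, Complex.norm_real, Real.norm_of_nonneg hx]

/-- A sector avoiding the negative real axis stays away from `-1`, uniformly and to scale. -/
theorem exists_le_norm_one_add_mul_cpow {α : ℝ} (hα0 : 0 < α) (hα2 : α < 2) :
    ∃ δ : ℝ, 0 < δ ∧ ∀ x : ℝ, 0 ≤ x → ∀ s : ℂ, 0 < s.re →
      δ * (1 + x * ‖s‖ ^ (-α)) ≤ ‖1 + (x : ℂ) * s ^ ((-α : ℝ) : ℂ)‖ := by
  have hpi := Real.pi_pos
  set q : ℝ := Real.cos (Real.pi / 2 * α) with hq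
  have hq1 : -1 < q := by
    rw [hq, ← Real.cos_pi]
    exact Real.cos_lt_cos_of_nonneg_of_le_pi (by positivity) le_rfl (by nlinarith)
  refine ⟨√((1 + q) / 2), Real.sqrt_pos.2 (by linarith), fun x hx s hs => ?_⟩
  set w : ℂ := (x : ℂ) * s ^ ((-α : ℝ) : ℂ) with hw
  have hwn : ‖w‖ = x * ‖s‖ ^ (-α) := norm_cpow_ofReal_mul x hx α s
  have hwr : q * ‖w‖ ≤ w.re := by
    rw [hwn, hw, Complex.re_ofReal_mul, Complex.cpow_ofReal_re]
    have harg := Complex.abs_arg_le_pi_div_two_iff.2 hs.le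
    have hcos : q ≤ Real.cos (Complex.arg s * -α) := by
      rw [← Real.cos_abs (Complex.arg s * -α), abs_mul, abs_neg, abs_of_pos hα0]
      exact Real.cos_le_cos_of_nonneg_of_le_pi (by positivity) (by nlinarith) (by gcongr)
    have : 0 ≤ x * ‖s‖ ^ (-α) := by positivity
    nlinarith
  rw [← hwn]
  refine le_of_sq_le_sq ?_ (norm_nonneg _)
  rw [mul_pow, Real.sq_sqrt (by linarith)]
  have h1 : ‖1 + w‖ ^ 2 = 1 + 2 * w.re + ‖w‖ ^ 2 := by
    rw [Complex.sq_norm, Complex.sq_norm, Complex.normSq_apply, Complex.normSq_apply]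
    simp
    ring
  rw [h1]
  have hq2 : q ≤ 1 := Real.cos_le_one _
  nlinarith [mul_nonneg (by linarith : 0 ≤ 1 - q) (sq_nonneg (1 - ‖w‖))]

/-- The Laplace-side kernel whose inverse Laplace transform at `1` is `E_{α,β}(-x)`; it is minus
the derivative of `s ^ (α - β) / (s ^ α + x)`. -/
noncomputable def mittagLefflerKernel (α β x : ℝ) (s : ℂ) : ℂ :=
  s ^ ((-(β + 1) : ℝ) : ℂ) * (β / (1 + x * s ^ ((-α : ℝ) : ℂ)) -
    α * (x * s ^ ((-α : ℝ) : ℂ)) / (1 + x * s ^ ((-α : ℝ) : ℂ)) ^ 2)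

theorem exists_norm_mittagLefflerKernel_le {α β : ℝ} (hα0 : 0 < α) (hα2 : α < 2) (hβ : 0 < β) :
    ∃ K : ℝ, 0 < K ∧ ∀ x : ℝ, 0 ≤ x → ∀ s : ℂ, 0 < s.re →
      ‖mittagLefflerKernel α β x s‖ ≤ K * (‖s‖ ^ (-(β + 1)) / (1 + x * ‖s‖ ^ (-α))) := by
  obtain ⟨δ, hδ, h⟩ := exists_le_norm_one_add_mul_cpow hα0 hα2
  refine ⟨β / δ + α / δ ^ 2, by positivity, fun x hx s hs => ?_⟩
  have hw := h x hx s hs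
  rw [mittagLefflerKernel, norm_mul, Complex.norm_cpow_real]
  have hwn := norm_cpow_ofReal_mul x hx α s
  generalize (x : ℂ) * s ^ ((-α : ℝ) : ℂ) = w at hw hwn ⊢
  rw [← hwn] at hw ⊢
  have h1 : 0 < 1 + ‖w‖ := by positivity
  have h2 : ‖(β : ℂ) / (1 + w) - α * w / (1 + w) ^ 2‖ ≤
      (β / δ + α / δ ^ 2) / (1 + ‖w‖) := by
    calc _ ≤ ‖(β : ℂ) / (1 + w)‖ + ‖α * w / (1 + w) ^ 2‖ := norm_sub_le _ _
      _ = β / ‖1 + w‖ + α * ‖w‖ / ‖1 + w‖ ^ 2 := by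
        simp [abs_of_pos hα0, abs_of_pos hβ]
      _ ≤ β / (δ * (1 + ‖w‖)) + α * (1 + ‖w‖) / (δ * (1 + ‖w‖)) ^ 2 := by
        gcongr
        linarith
      _ = _ := by field_simp
  calc _ ≤ ‖s‖ ^ (-(β + 1)) * ((β / δ + α / δ ^ 2) / (1 + ‖w‖)) := by gcongr
    _ = _ := by ring

theorem differentiableOn_mittagLefflerKernel {α β x : ℝ} (hα0 : 0 < α) (hα2 : α < 2)
    (hx : 0 ≤ x) : DifferentiableOn ℂ (mittagLefflerKernel α β x) {z | 0 < z.re} := by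
  obtain ⟨δ, hδ, h⟩ := exists_le_norm_one_add_mul_cpow hα0 hα2
  intro s (hs : 0 < s.re)
  have hne : 1 + (x : ℂ) * s ^ ((-α : ℝ) : ℂ) ≠ 0 := by
    rw [← norm_pos_iff]
    exact lt_of_lt_of_le (by positivity) (h x hx s hs)
  have hpow : ∀ r : ℂ, DifferentiableAt ℂ (fun s : ℂ => s ^ r) s := fun r =>
    differentiableAt_id.cpow_const (Or.inl hs)
  have hw := (hpow ((-α : ℝ) : ℂ)).const_mul (x : ℂ)
  have hw1 := hw.const_add 1
  exact ((hpow _).mul (((differentiableAt_const _).div hw1 hne).sub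
    ((hw.const_mul (α : ℂ)).div (hw1.pow 2) (pow_ne_zero 2 hne)))).differentiableWithinAt

theorem norm_cexp_mul_coe_mul_cpow {c : ℝ} (y r : ℝ) (w : ℂ) :
    ‖Complex.exp (c + y * Complex.I) * (w * (c + y * Complex.I : ℂ) ^ (r : ℂ))‖ =
      Real.exp c * ‖w‖ * ‖(c + y * Complex.I : ℂ)‖ ^ r := by
  rw [norm_mul, norm_mul, Complex.norm_exp, Complex.norm_cpow_real, mul_assoc]
  simp

theorem two_pi_mul_mittagLeffler_neg {α β x c : ℝ} (hα : 0 < α) (hβ : 0 < β) (hx : 0 ≤ x)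
    (hc : 0 < c) (hxc : x * c ^ (-α) < 1) :
    2 * Real.pi * mittagLeffler α β ((-x : ℝ) : ℂ) =
      ∫ y : ℝ, Complex.exp (c + y * Complex.I) *
        mittagLefflerKernel α β x (c + y * Complex.I) := by
  set q : ℝ := x * c ^ (-α) with hq
  have hq0 : 0 ≤ q := by positivity
  set J : ℝ := ∫ y : ℝ, ‖(c + y * Complex.I : ℂ)‖ ^ (-(β + 1)) with hJ
  have hJi := integrable_norm_add_mul_I_rpow hc (p := β + 1) (by linarith)
  set F : ℕ → ℝ → ℂ := fun k y => Complex.exp (c + y * Complex.I) *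
    (((-x) ^ k * (α * k + β) : ℝ) * (c + y * Complex.I : ℂ) ^ ((-(α * k + β + 1) : ℝ) : ℂ))
    with hF
  have hs : ∀ y : ℝ, c ≤ ‖(c + y * Complex.I : ℂ)‖ := fun y => by
    have := (Complex.abs_re_le_norm (c + y * Complex.I : ℂ))
    simp at this
    exact (le_abs_self c).trans this
  have hFb : ∀ k y, ‖F k y‖ ≤ Real.exp c * ((α * k + β) * q ^ k) *
      ‖(c + y * Complex.I : ℂ)‖ ^ (-(β + 1)) := by
    intro k y
    have hpos : 0 < ‖(c + y * Complex.I : ℂ)‖ := hc.trans_le (hs y)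
    have h1 : ‖(c + y * Complex.I : ℂ)‖ ^ (-(α * k + β + 1)) ≤
        (c ^ (-α)) ^ k * ‖(c + y * Complex.I : ℂ)‖ ^ (-(β + 1)) := by
      rw [show -(α * k + β + 1) = (-α) * k + -(β + 1) by ring, Real.rpow_add hpos,
        Real.rpow_mul_natCast hpos.le]
      gcongr ?_ ^ k * _
      exact Real.rpow_le_rpow_of_nonpos hc (hs y) (by linarith)
    rw [hF, norm_cexp_mul_coe_mul_cpow, Complex.norm_real, Real.norm_eq_abs, abs_mul, abs_pow,
      abs_neg, abs_of_nonneg hx, abs_of_pos (by positivity : 0 < α * k + β)]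
    calc _ ≤ Real.exp c * (x ^ k * (α * k + β)) *
          ((c ^ (-α)) ^ k * ‖(c + y * Complex.I : ℂ)‖ ^ (-(β + 1))) := by gcongr
      _ = _ := by rw [hq, mul_pow]; ring
  have hFi : ∀ k, Integrable (F k) := fun k =>
    (hJi.const_mul (Real.exp c * ((α * k + β) * q ^ k))).mono'
      (Measurable.aestronglyMeasurable (by fun_prop)) (Filter.Eventually.of_forall (hFb k))
  have hsum : Summable fun k : ℕ => (α * k + β) * q ^ k := by
    have hq1 : ‖q‖ < 1 := by rwa [Real.norm_of_nonneg hq0]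
    have h1 := ((hasSum_coe_mul_geometric_of_norm_lt_one hq1).summable.mul_left α).add
      ((summable_geometric_of_lt_one hq0 hxc).mul_left β)
    exact h1.congr fun k => by ring
  have hFs : Summable fun k => ∫ y, ‖F k y‖ := by
    refine Summable.of_nonneg_of_le (fun k => integral_nonneg fun y => norm_nonneg _)
      (fun k => ?_) ((hsum.mul_left (Real.exp c)).mul_right J)
    rw [hJ, ← integral_const_mul]
    exact integral_mono (hFi k).norm (hJi.const_mul _) (hFb k)
  have hmain := hasSum_integral_of_summable_integral_norm hFi hFs
  have hterm : ∀ k : ℕ, ∫ y, F k y = 2 * Real.pi *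
      (((-x : ℝ) : ℂ) ^ k / Complex.Gamma ((α * k + β : ℝ) : ℂ)) := by
    intro k
    have hpos : 0 < α * k + β := by positivity
    have hne : ((α * k + β : ℝ) : ℂ) ≠ 0 := by exact_mod_cast hpos.ne'
    have h := integral_cexp_mul_cpow_eq hc (p := α * k + β + 1) (by linarith)
    simp only [hF, mul_left_comm (Complex.exp _)]
    rw [integral_const_mul]
    simp only [Complex.ofReal_neg (α * k + β + 1)]
    rw [h, Complex.ofReal_add _ 1, Complex.ofReal_one, Complex.Gamma_add_one _ hne,
      Complex.ofReal_mul, Complex.ofReal_pow]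
    have hG : Complex.Gamma ((α * k + β : ℝ) : ℂ) ≠ 0 :=
      Complex.Gamma_ne_zero_of_re_pos (by simpa using hpos)
    field_simp
  have hpt : ∀ y : ℝ, ∑' k, F k y = Complex.exp (c + y * Complex.I) *
        mittagLefflerKernel α β x (c + y * Complex.I) := by
    intro y
    set s : ℂ := c + y * Complex.I with hsdef
    have hs0 : s ≠ 0 := add_mul_I_ne_zero hc y
    set w : ℂ := x * s ^ ((-α : ℝ) : ℂ) with hw
    have hwn : ‖-w‖ < 1 := by
      rw [norm_neg, hw, norm_cpow_ofReal_mul x hx]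
      refine lt_of_le_of_lt ?_ hxc
      exact mul_le_mul_of_nonneg_left
        (Real.rpow_le_rpow_of_nonpos hc (hs y) (by linarith)) hx
    have h1 := ((((hasSum_coe_mul_geometric_of_norm_lt_one hwn).mul_left (α : ℂ)).add
      ((hasSum_geometric_of_norm_lt_one hwn).mul_left (β : ℂ))).mul_left
        (s ^ ((-(β + 1) : ℝ) : ℂ))).mul_left (Complex.exp s)
    have h2 : ∀ k, F k y = Complex.exp s * (s ^ ((-(β + 1) : ℝ) : ℂ) *
        (α * (k * (-w) ^ k) + β * (-w) ^ k)) := by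
      intro k
      have h3 : s ^ ((-(α * k + β + 1) : ℝ) : ℂ) =
          s ^ ((-(β + 1) : ℝ) : ℂ) * (s ^ ((-α : ℝ) : ℂ)) ^ k := by
        rw [← Complex.cpow_mul_nat, ← Complex.cpow_add _ _ hs0]
        congr 1
        push_cast
        ring
      simp only [hF, ← hsdef, h3, hw]
      rw [neg_pow (_ * _), mul_pow, neg_pow x]
      push_cast
      ring
    rw [tsum_congr h2, h1.tsum_eq, mittagLefflerKernel, ← hw]
    ring
  simp only [hpt, hterm] at hmain
  rw [← hmain.tsum_eq, mittagLeffler, tsum_mul_left]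

theorem exists_norm_mittagLeffler_neg_le {α β r : ℝ} (hα1 : 1 < α) (hα2 : α < 2) (hβ : 0 < β)
    (hr0 : 0 ≤ r) (hr1 : r ≤ 1) (hr : α * r < β) :
    ∃ C : ℝ, 0 < C ∧ ∀ x : ℝ, 0 < x →
      ‖mittagLeffler α β ((-x : ℝ) : ℂ)‖ ≤ C * x ^ (-r) := by
  have hα0 : 0 < α := by linarith
  obtain ⟨K, hK, hker⟩ := exists_norm_mittagLefflerKernel_le hα0 hα2 hβ
  set J : ℝ := ∫ y : ℝ, ‖((1 : ℝ) + y * Complex.I : ℂ)‖ ^ (-(β + 1 - α * r)) with hJ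
  have hJi := integrable_norm_add_mul_I_rpow one_pos (p := β + 1 - α * r) (by linarith)
  have hJ0 : 0 ≤ J := integral_nonneg fun y => by positivity
  refine ⟨Real.exp 1 * K * J + 1, by positivity, fun x hx => ?_⟩
  have hc : 1 ≤ 1 + x := by linarith
  have hxc : x * (1 + x) ^ (-α) < 1 := by
    rw [Real.rpow_neg (by linarith), ← div_eq_mul_inv, div_lt_one (by positivity)]
    have := Real.rpow_le_rpow_of_exponent_le hc hα1.le
    rw [Real.rpow_one] at this
    linarith
  set g : ℂ → ℂ := fun s => Complex.exp s * mittagLefflerKernel α β x s with hg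
  have hgd : DifferentiableOn ℂ g {z | 0 < z.re} :=
    Complex.differentiable_exp.differentiableOn.mul
      (differentiableOn_mittagLefflerKernel hα0 hα2 hx.le)
  have hgb : ∀ s : ℂ, 0 < s.re →
      ‖g s‖ ≤ Real.exp s.re * (K * (‖s‖ ^ (-(β + 1)) / (1 + x * ‖s‖ ^ (-α)))) := by
    intro s hs
    rw [hg, norm_mul, Complex.norm_exp]
    gcongr
    exact hker x hx.le s hs
  have hshift : ∫ y : ℝ, g ((1 : ℝ) + y * Complex.I) =
      ∫ y : ℝ, g ((1 + x : ℝ) + y * Complex.I) := by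
    refine integral_vertical_line_eq (M := Real.exp (1 + x) * K) (p := β + 1) one_pos hc
      (by linarith) (by positivity) hgd fun s hs1 hs2 => (hgb s (by linarith)).trans ?_
    rw [mul_assoc]
    gcongr
    exact div_le_self (by positivity) (le_add_of_nonneg_right (by positivity))
  have hE := two_pi_mul_mittagLeffler_neg hα0 hβ hx.le (by linarith) hxc
  have hpt : ∀ y : ℝ, ‖g ((1 : ℝ) + y * Complex.I)‖ ≤ Real.exp 1 * K * x ^ (-r) *
      ‖((1 : ℝ) + y * Complex.I : ℂ)‖ ^ (-(β + 1 - α * r)) := by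
    intro y
    refine (hgb _ (by simp)).trans ?_
    have hpos : 0 < ‖((1 : ℝ) + y * Complex.I : ℂ)‖ :=
      norm_pos_iff.2 (add_mul_I_ne_zero one_pos y)
    have hre : ((1 : ℝ) + y * Complex.I : ℂ).re = 1 := by simp
    rw [hre]
    generalize ‖((1 : ℝ) + y * Complex.I : ℂ)‖ = m at hpos ⊢
    have hm : 0 < x * m ^ (-α) := by positivity
    have hle : (x * m ^ (-α)) ^ r ≤ 1 + x * m ^ (-α) := by
      calc (x * m ^ (-α)) ^ r ≤ (1 + x * m ^ (-α)) ^ r := by gcongr; linarith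
        _ ≤ (1 + x * m ^ (-α)) ^ (1 : ℝ) :=
          Real.rpow_le_rpow_of_exponent_le (by linarith) hr1
        _ = _ := Real.rpow_one _
    have hmr : (x * m ^ (-α)) ^ r = x ^ r * m ^ (-(α * r)) := by
      rw [Real.mul_rpow hx.le (by positivity), ← Real.rpow_mul hpos.le, neg_mul]
    calc Real.exp 1 * (K * (m ^ (-(β + 1)) / (1 + x * m ^ (-α))))
        ≤ Real.exp 1 * (K * (m ^ (-(β + 1)) / (x ^ r * m ^ (-(α * r))))) := by
          rw [hmr] at hle
          gcongr
      _ = Real.exp 1 * K * x ^ (-r) * m ^ (-(β + 1 - α * r)) := by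
          rw [show -(β + 1 - α * r) = -(β + 1) - -(α * r) by ring, Real.rpow_sub hpos,
            Real.rpow_neg hx.le]
          field_simp
  have hnorm : ‖∫ y : ℝ, g ((1 : ℝ) + y * Complex.I)‖ ≤ Real.exp 1 * K * x ^ (-r) * J := by
    rw [hJ, ← integral_const_mul]
    exact norm_integral_le_of_norm_le (hJi.const_mul _) (Filter.Eventually.of_forall hpt)
  rw [hshift, hg, ← hE, norm_mul] at hnorm
  have h2 : 1 ≤ ‖(2 * Real.pi : ℂ)‖ := by
    rw [norm_mul, Complex.norm_real, Real.norm_of_nonneg Real.pi_pos.le, Complex.norm_ofNat]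
    linarith [Real.pi_gt_three]
  have hx' : 0 < x ^ (-r) := by positivity
  calc ‖mittagLeffler α β ((-x : ℝ) : ℂ)‖
      ≤ ‖(2 * Real.pi : ℂ)‖ * ‖mittagLeffler α β ((-x : ℝ) : ℂ)‖ :=
        le_mul_of_one_le_left (norm_nonneg _) h2
    _ ≤ Real.exp 1 * K * x ^ (-r) * J := hnorm
    _ ≤ _ := by nlinarith

/-- Spectral-coefficient form of the estimate
`‖∂_t^α u‖_{L²(0,T;D(A^{-θ}))} ≤ C(‖u₀‖_{H¹₀(Ω)} + ‖u₁‖_{L²(Ω)})`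
for `θ ∈ ((α-1)/(2α), 1/2)`. -/
theorem fractional_derivative_L2_estimate (α T θ : ℝ) (hα1 : 1 < α) (hα2 : α < 2)
    (hT : 0 < T) (hθ1 : (α - 1) / (2 * α) < θ) (hθ2 : θ < 1 / 2)
    (lam a b : ℕ → ℝ) (hlam : ∀ n, 0 < lam n)
    (ha : Summable (fun n => lam n * (a n) ^ 2))
    (hb : Summable (fun n => (b n) ^ 2)) :
    ∃ C : ℝ, 0 < C ∧
      ∫⁻ t in Set.Ioo (0 : ℝ) T, ∑' n : ℕ, ENNReal.ofReal ((lam n) ^ (2 - 2 * θ) *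
          ‖((a n : ℝ) : ℂ) * mittagLeffler α 1 ((-(lam n * t ^ α) : ℝ) : ℂ)
            + ((b n * t : ℝ) : ℂ) * mittagLeffler α 2 ((-(lam n * t ^ α) : ℝ) : ℂ)‖ ^ 2)
        ≤ ENNReal.ofReal (C * ((∑' n : ℕ, lam n * (a n) ^ 2) + ∑' n : ℕ, (b n) ^ 2)) := by
  have hα0 : 0 < α := by linarith
  have hθ1' : α - 1 < 2 * α * θ := by
    rwa [div_lt_iff₀ (by positivity), mul_comm] at hθ1
  have hθ0 : 0 < θ := lt_trans (by apply div_pos <;> linarith) hθ1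
  obtain ⟨C₁, hC₁, hE₁⟩ := exists_norm_mittagLeffler_neg_le (β := 1) (r := (1 - 2 * θ) / 2)
    hα1 hα2 one_pos (by linarith) (by linarith) (by nlinarith)
  obtain ⟨C₂, hC₂, hE₂⟩ := exists_norm_mittagLeffler_neg_le (β := 2) (r := 1 - θ)
    hα1 hα2 two_pos (by linarith) (by linarith) (by nlinarith)
  set A : ℝ := ∑' n : ℕ, lam n * (a n) ^ 2 with hA
  set B : ℝ := ∑' n : ℕ, (b n) ^ 2 with hB
  have hA0 : 0 ≤ A := tsum_nonneg fun n => mul_nonneg (hlam n).le (sq_nonneg _)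
  have hB0 : 0 ≤ B := tsum_nonneg fun n => sq_nonneg _
  set p : ℝ := -(α * (1 - 2 * θ)) with hp
  set q : ℝ := 2 - α * (2 - 2 * θ) with hq
  set D : ℝ → ℝ := fun t => 2 * C₁ ^ 2 * t ^ p + 2 * C₂ ^ 2 * t ^ q with hD
  have hint : ∀ r : ℝ, -1 < r → IntegrableOn (fun t : ℝ => t ^ r) (Set.Ioo 0 T) := by
    intro r hr
    rw [← integrableOn_Ioc_iff_integrableOn_Ioo, ← intervalIntegrable_iff_integrableOn_Ioc_of_le
      hT.le]
    exact intervalIntegral.intervalIntegrable_rpow' hr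
  have hDi : IntegrableOn D (Set.Ioo 0 T) :=
    ((hint p (by rw [hp]; nlinarith)).const_mul _).add
      ((hint q (by rw [hq]; nlinarith)).const_mul _)
  have hD0 : ∀ t, 0 < t → 0 ≤ D t := fun t ht => by simp only [hD]; positivity
  have hterm : ∀ t, 0 < t → ∀ n, (lam n) ^ (2 - 2 * θ) *
      ‖((a n : ℝ) : ℂ) * mittagLeffler α 1 ((-(lam n * t ^ α) : ℝ) : ℂ)
        + ((b n * t : ℝ) : ℂ) * mittagLeffler α 2 ((-(lam n * t ^ α) : ℝ) : ℂ)‖ ^ 2 ≤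
      2 * C₁ ^ 2 * t ^ p * (lam n * (a n) ^ 2) + 2 * C₂ ^ 2 * t ^ q * (b n) ^ 2 := by
    intro t ht n
    have hl := hlam n
    have hx : 0 < lam n * t ^ α := by positivity
    have h1 := hE₁ _ hx
    have h2 := hE₂ _ hx
    have hsq : ∀ r : ℝ, ((lam n * t ^ α) ^ (-r)) ^ 2 =
        lam n ^ (-(2 * r)) * t ^ (-(α * (2 * r))) := by
      intro r
      rw [← Real.rpow_mul_natCast hx.le, Real.mul_rpow hl.le (by positivity),
        ← Real.rpow_mul ht.le]
      congr 2 <;> push_cast <;> ring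
    have hn : ‖((a n : ℝ) : ℂ) * mittagLeffler α 1 ((-(lam n * t ^ α) : ℝ) : ℂ)
        + ((b n * t : ℝ) : ℂ) * mittagLeffler α 2 ((-(lam n * t ^ α) : ℝ) : ℂ)‖ ≤
        |a n| * (C₁ * (lam n * t ^ α) ^ (-((1 - 2 * θ) / 2))) +
        |b n| * t * (C₂ * (lam n * t ^ α) ^ (-(1 - θ))) := by
      refine (norm_add_le _ _).trans ?_
      rw [norm_mul, norm_mul, Complex.norm_real, Complex.norm_real, Real.norm_eq_abs,
        Real.norm_eq_abs, abs_mul, abs_of_pos ht]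
      gcongr
    have hadd : ∀ u v : ℝ, (u + v) ^ 2 ≤ 2 * u ^ 2 + 2 * v ^ 2 := fun u v => by
      nlinarith [sq_nonneg (u - v)]
    calc _ ≤ lam n ^ (2 - 2 * θ) *
          (|a n| * (C₁ * (lam n * t ^ α) ^ (-((1 - 2 * θ) / 2))) +
            |b n| * t * (C₂ * (lam n * t ^ α) ^ (-(1 - θ)))) ^ 2 := by gcongr
      _ ≤ lam n ^ (2 - 2 * θ) *
          (2 * (|a n| * (C₁ * (lam n * t ^ α) ^ (-((1 - 2 * θ) / 2)))) ^ 2 +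
            2 * (|b n| * t * (C₂ * (lam n * t ^ α) ^ (-(1 - θ)))) ^ 2) := by
        gcongr
        exact hadd _ _
      _ = 2 * C₁ ^ 2 * t ^ p *
            ((lam n ^ (2 - 2 * θ) * lam n ^ (-(2 * ((1 - 2 * θ) / 2)))) * (a n) ^ 2) +
          2 * C₂ ^ 2 * (t ^ 2 * t ^ (-(α * (2 * (1 - θ))))) *
            ((lam n ^ (2 - 2 * θ) * lam n ^ (-(2 * (1 - θ)))) * (b n) ^ 2) := by
        simp only [mul_pow, hsq, sq_abs]
        rw [hp, show α * (2 * ((1 - 2 * θ) / 2)) = α * (1 - 2 * θ) by ring]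
        ring
      _ = _ := by
        rw [← Real.rpow_add hl, ← Real.rpow_add hl, ← Real.rpow_natCast t 2,
          ← Real.rpow_add ht, show 2 - 2 * θ + -(2 * ((1 - 2 * θ) / 2)) = 1 by ring,
          show 2 - 2 * θ + -(2 * (1 - θ)) = 0 by ring,
          show ((2 : ℕ) : ℝ) + -(α * (2 * (1 - θ))) = q by rw [hq]; push_cast; ring,
          Real.rpow_one, Real.rpow_zero, one_mul]
  have hpt : ∀ t ∈ Set.Ioo (0 : ℝ) T, ∑' n : ℕ, ENNReal.ofReal ((lam n) ^ (2 - 2 * θ) *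
          ‖((a n : ℝ) : ℂ) * mittagLeffler α 1 ((-(lam n * t ^ α) : ℝ) : ℂ)
            + ((b n * t : ℝ) : ℂ) * mittagLeffler α 2 ((-(lam n * t ^ α) : ℝ) : ℂ)‖ ^ 2) ≤
      ENNReal.ofReal (D t * (A + B)) := by
    intro t ht
    have ht0 : 0 < t := ht.1
    have hs₁ := ha.mul_left (2 * C₁ ^ 2 * t ^ p)
    have hs₂ := hb.mul_left (2 * C₂ ^ 2 * t ^ q)
    refine (ENNReal.tsum_le_tsum fun n => ENNReal.ofReal_le_ofReal (hterm t ht0 n)).trans ?_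
    rw [← ENNReal.ofReal_tsum_of_nonneg (fun n => ?_) (hs₁.add hs₂), hs₁.tsum_add hs₂,
      tsum_mul_left, tsum_mul_left, ← hA, ← hB]
    · refine ENNReal.ofReal_le_ofReal ?_
      have hc₁ : 0 ≤ 2 * C₁ ^ 2 * t ^ p := by positivity
      have hc₂ : 0 ≤ 2 * C₂ ^ 2 * t ^ q := by positivity
      simp only [hD]
      nlinarith [mul_nonneg hc₁ hB0, mul_nonneg hc₂ hA0]
    · have := hlam n
      positivity
  have hI0 : 0 ≤ ∫ t in Set.Ioo 0 T, D t :=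
    setIntegral_nonneg measurableSet_Ioo fun t ht => hD0 t ht.1
  refine ⟨(∫ t in Set.Ioo 0 T, D t) + 1, by linarith, ?_⟩
  refine (setLIntegral_mono' measurableSet_Ioo hpt).trans ?_
  rw [← ofReal_integral_eq_lintegral_ofReal (hDi.mul_const _) ?_, integral_mul_const]
  · refine ENNReal.ofReal_le_ofReal ?_
    gcongr
    linarith
  · filter_upwards [ae_restrict_mem measurableSet_Ioo] with t ht
    exact mul_nonneg (hD0 t ht.1) (add_nonneg hA0 hB0)
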